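/- Let i be a Pareto optimal index that is not the global minimizer of d. Then the set { j : i < j and d j < d i } is nonempty, and its least element is itself Pareto optimal. (This is the correctness of one step of the greedy walk: from a Pareto optimal city that is not the closest city, moving to the largest strictly closer city reaches the next Pareto optimum.) -/

import Mathlib

/-- Index `i` is Pareto optimal: no index `j` dominates it, i.e. there is no `j < i`
(a larger city) with `d j < d i` (also strictly closer to the query). -/
def ParetoOptimal {n : ℕ} (d : Fin n → ℝ) (i : Fin n) : Prop :=
  ¬ ∃ j, j < i ∧ d j < d i

/-- One step of the greedy walk: if `i` is Pareto optimal but not the global minimizer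
of `d`, then the set `{ j | i < j ∧ d j < d i }` is nonempty and its least element is
itself Pareto optimal. -/
theorem pareto_greedy_step (n : ℕ) (hn : 1 ≤ n) (d : Fin n → ℝ)
    (hd : Function.Injective d) (i : Fin n)
    (hi : ParetoOptimal d i) (hnotmin : ¬ ∀ j, d i ≤ d j) :
    {j : Fin n | i < j ∧ d j < d i}.Nonempty ∧
      ∀ j : Fin n, IsLeast {j : Fin n | i < j ∧ d j < d i} j →
        ParetoOptimal d j := by
  refine ⟨?_, ?_⟩
  · push Not at hnotmin
    obtain ⟨j, hj⟩ := hnotmin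
    refine ⟨j, lt_of_not_ge fun hji => ?_, hj⟩
    rcases hji.lt_or_eq with hlt | rfl
    · exact hi ⟨j, hlt, hj⟩
    · exact lt_irrefl _ hj
  · rintro j ⟨⟨_, hji⟩, hleast⟩ ⟨k, hkj, hdk⟩
    have hki : d k < d i := hdk.trans hji
    rcases lt_trichotomy k i with hlt | rfl | hgt
    · exact hi ⟨k, hlt, hki⟩
    · exact lt_irrefl _ hki
    · exact (hleast ⟨hgt, hki⟩).not_gt hkj
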